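/- Let A be a multipartition matrix with k blocks, m pairwise distinct columns, that is staged and balanced (equivalently, the matrix of a stratified, balanced staged tree), and let d be a normalized data vector with positive entries. Then the iterative proportional scaling algorithm produces the MLE of d in M_A after one cycle: the iterate q^k, obtained from the uniform distribution q^0 = (1/m,…,1/m) by the k steps q^ℓ_j = q^{ℓ−1}_j · (α^ℓ_{S(ℓ,j)} · d)/(α^ℓ_{S(ℓ,j)} · q^{ℓ−1}), is the maximum likelihood estimate of d in M_A. -/

import Mathlib

open Finset

namespace PM

variable {k : ℕ} {J : Type*} {I : Type*} [Fintype J] [DecidableEq J] [DecidableEq I]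

/- A partition matrix (a 0/1 matrix in which every column sums to 1), with columns
indexed by `J` and rows indexed by `I`, is encoded by the map sending each column to the
unique row having a 1 in that column.  A multipartition matrix with `k` blocks is a
family `S : Fin k → J → I` of such maps (block `b` is the partition matrix whose row
through column `j` is `S b j`). -/

/-- Columns `j` and `j'` agree in the first `ℓ` blocks (blocks of index `< ℓ`). -/
def colEquiv (S : Fin k → J → I) (ℓ : ℕ) (j j' : J) : Prop :=
  ∀ b : Fin k, (b : ℕ) < ℓ → S b j = S b j'

instance {S : Fin k → J → I} {ℓ : ℕ} {j j' : J} : Decidable (colEquiv S ℓ j j') :=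
  inferInstanceAs (Decidable (∀ b : Fin k, (b : ℕ) < ℓ → S b j = S b j'))

/-- The column weight `c^ℓ_j` of column `j` in the stacked matrix of the first `ℓ` blocks. -/
def colWeight (S : Fin k → J → I) (ℓ : ℕ) (j : J) : ℕ :=
  (univ.filter fun j' => colEquiv S ℓ j j').card

/-- Well-connectedness: for every block `b` and all columns `j`, `j'` in the support of one
row of block `b`, `c^{b+1}_j / c^{b}_j = c^{b+1}_{j'} / c^{b}_{j'}` (cross-multiplied;
here `b+1` counts blocks, so `colWeight S ((b:ℕ)+1)` includes block `b`, and the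
condition is trivially true for the first block). -/
def WellConnected (S : Fin k → J → I) : Prop :=
  ∀ (b : Fin k) (j j' : J), S b j = S b j' →
    colWeight S ((b : ℕ) + 1) j * colWeight S (b : ℕ) j' =
      colWeight S ((b : ℕ) + 1) j' * colWeight S (b : ℕ) j

/-- The set of rows of block `b` connected to the row of `B_b = ∪_{n<b} A^n` supported
on column `j` (a floret of block `b`, represented by the column `j`). -/
def stage (S : Fin k → J → I) (b : Fin k) (j : J) : Finset I :=
  (univ.filter fun j' => colEquiv S (b : ℕ) j j').image (S b)

/-- The pair `(∪_{n<b} A^n, A^b)` satisfies the floret condition: the sets of rows of the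
block `b` connected to two rows of `B_b` are equal or disjoint. -/
def FloretCondition (S : Fin k → J → I) (b : Fin k) : Prop :=
  ∀ j j' : J, stage S b j = stage S b j' ∨ Disjoint (stage S b j) (stage S b j')

/-- The `i`-th row of block `b`, as a real vector. -/
def rowVec (S : Fin k → J → I) (b : Fin k) (i : I) : J → ℝ :=
  fun j => if S b j = i then 1 else 0

/-- `α^b_i · d`, the dot product of the `i`-th row of block `b` with `d`. -/
def rowDot (S : Fin k → J → I) (b : Fin k) (i : I) (d : J → ℝ) : ℝ :=
  ∑ j, (if S b j = i then d j else 0)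

/-- The set of rows of the stacked matrix consisting of the first `ℓ` blocks. -/
def prefixRows (S : Fin k → J → I) (ℓ : ℕ) : Set (J → ℝ) :=
  {v | ∃ (b : Fin k) (i : I), (b : ℕ) < ℓ ∧ v = rowVec S b i}

/-- The row of `D = B_b ∩ A^b` through column `j0` (the indicator vector of the columns
whose floret pair is that of `j0`). -/
def dRow (S : Fin k → J → I) (b : Fin k) (j0 : J) : J → ℝ :=
  fun j => if stage S b j = stage S b j0 then 1 else 0

/-- The generalized running intersection property: for every block `b ≥ 1` (paper:
`ℓ + 1` with `1 ≤ ℓ ≤ k-1`), (1) the stacked matrix of `B_b = ∪_{n<b}A^n` and `A^b` is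
well-connected, (2) the pair `(B_b, A^b)` satisfies the floret condition, and (3) every
row of `B_b ∩ A^b` lies in the real row span of the first `b` blocks. -/
def GRIP (S : Fin k → J → I) : Prop :=
  ∀ b : Fin k, 0 < (b : ℕ) →
    (∀ j j' : J, S b j = S b j' →
      colWeight S ((b : ℕ) + 1) j * colWeight S (b : ℕ) j' =
        colWeight S ((b : ℕ) + 1) j' * colWeight S (b : ℕ) j) ∧
    FloretCondition S b ∧
    (∀ j0 : J, dRow S b j0 ∈ Submodule.span ℝ (prefixRows S (b : ℕ)))

/-- The level-`b` floret `F^b[i]` containing the `i`-th row of block `b`. -/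
def floret (S : Fin k → J → I) (b : Fin k) (i : I) : Finset I :=
  (univ.filter fun j => S b j = i).biUnion fun j => stage S b j

/-- `Σ_{i' ∈ F^b[i]} α^b_{i'} · d`. -/
def floretSum (S : Fin k → J → I) (b : Fin k) (i : I) (d : J → ℝ) : ℝ :=
  ∑ j, (if S b j ∈ floret S b i then d j else 0)

/-- The likelihood `∏_j p_j^{d_j}` of data `d` at the point `p`. -/
noncomputable def likelihood (d p : J → ℝ) : ℝ := ∏ j, p j ^ d j

/-- The log-linear (partition) model determined by a set of rows: probability
vectors with positive entries whose coordinatewise logarithm lies in the row span. -/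
def inModel (Rows : Set (J → ℝ)) (p : J → ℝ) : Prop :=
  (∀ j, 0 < p j) ∧ (∑ j, p j) = 1 ∧
    (fun j => Real.log (p j)) ∈ Submodule.span ℝ Rows

/-- `p` is a maximum likelihood estimate for the data `d` in the model determined by
`Rows`: it maximizes the likelihood over the closure of the model. -/
def IsMLE (Rows : Set (J → ℝ)) (d p : J → ℝ) : Prop :=
  p ∈ closure {q | inModel Rows q} ∧
    ∀ q ∈ closure {q | inModel Rows q}, likelihood d q ≤ likelihood d p

/-- The iterative proportional scaling iterates: `ips S d 0` is the uniform
distribution, and step `ℓ+1` rescales by the `ℓ`-th block (`q^{ℓ+1}_j =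
q^ℓ_j ⬝ (α^ℓ_{S(ℓ,j)} · d) / (α^ℓ_{S(ℓ,j)} · q^ℓ)`). -/
noncomputable def ips (S : Fin k → J → I) (d : J → ℝ) : ℕ → J → ℝ
  | 0 => fun _ => (Fintype.card J : ℝ)⁻¹
  | ℓ + 1 => fun j =>
      if h : ℓ < k then
        ips S d ℓ j * rowDot S ⟨ℓ, h⟩ (S ⟨ℓ, h⟩ j) d /
          rowDot S ⟨ℓ, h⟩ (S ⟨ℓ, h⟩ j) (ips S d ℓ)
      else ips S d ℓ j

end PM

namespace PM

variable {k : ℕ} {J : Type*} {I : Type*} [Fintype J] [DecidableEq J] [DecidableEq I]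

/-- A multipartition matrix with pairwise distinct columns is *staged* if its associated
tree is a staged tree: for each level, the stages (sets of next-level rows reachable from
two columns agreeing up to that level) are equal or disjoint. -/
def Staged (S : Fin k → J → I) : Prop :=
  ∀ b : Fin k, 0 < (b : ℕ) → FloretCondition S b

/-- The interpolating polynomial `t_ℓ(j)` of the vertex of the tree determined by the
first `ℓ` edges along the root-to-leaf path of column `j`: the sum over all columns `j'`
agreeing with `j` in the first `ℓ` blocks of the product of the variables of their
remaining edges. -/
noncomputable def interp (S : Fin k → J → I) (ℓ : ℕ) (j : J) :
    MvPolynomial (Fin k × I) ℝ :=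
  ∑ j' ∈ Finset.univ.filter (fun j' => colEquiv S ℓ j j'),
    ∏ b ∈ Finset.univ.filter (fun b : Fin k => ℓ ≤ (b : ℕ)),
      MvPolynomial.X (b, S b j')

/-- A staged multipartition matrix with pairwise distinct columns is *balanced* if for
every level `b ≥ 1`, any two vertices in the same stage (columns `j`, `j''` with equal
stages), and any matching pairs of children (columns `j₁, j₂ ∼_b j` and
`j₁'', j₂'' ∼_b j''` with `S b j₁ = S b j₁''` and `S b j₂ = S b j₂''`), one has
`t(j₁) t(j₂'') = t(j₁'') t(j₂)` as polynomials. -/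
def Balanced (S : Fin k → J → I) : Prop :=
  ∀ b : Fin k, 0 < (b : ℕ) →
    ∀ j j'' : J, stage S b j = stage S b j'' →
      ∀ j₁ j₂ j₁'' j₂'' : J,
        colEquiv S (b : ℕ) j j₁ → colEquiv S (b : ℕ) j j₂ →
        colEquiv S (b : ℕ) j'' j₁'' → colEquiv S (b : ℕ) j'' j₂'' →
        S b j₁ = S b j₁'' → S b j₂ = S b j₂'' →
        interp S ((b : ℕ) + 1) j₁ * interp S ((b : ℕ) + 1) j₂'' =
          interp S ((b : ℕ) + 1) j₁'' * interp S ((b : ℕ) + 1) j₂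

end PM

namespace PM

set_option linter.unusedSectionVars false

section Aux

variable {k : ℕ} {J : Type*} {I : Type*} [Fintype J] [DecidableEq J] [DecidableEq I]

theorem colEquiv.refl' (S : Fin k → J → I) (ℓ : ℕ) (j : J) : colEquiv S ℓ j j :=
  fun _ _ => rfl

theorem colEquiv.symm' {S : Fin k → J → I} {ℓ : ℕ} {j j' : J} (h : colEquiv S ℓ j j') :
    colEquiv S ℓ j' j := fun b hb => (h b hb).symm

theorem colEquiv.trans' {S : Fin k → J → I} {ℓ : ℕ} {j j' j'' : J} (h : colEquiv S ℓ j j')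
    (h' : colEquiv S ℓ j' j'') : colEquiv S ℓ j j'' :=
  fun b hb => (h b hb).trans (h' b hb)

theorem colEquiv_comm (S : Fin k → J → I) (ℓ : ℕ) (j j' : J) :
    colEquiv S ℓ j j' ↔ colEquiv S ℓ j' j := ⟨fun h => h.symm', fun h => h.symm'⟩

theorem colEquiv_congr {S : Fin k → J → I} {ℓ : ℕ} {j j' : J} (h : colEquiv S ℓ j j') (i : J) :
    colEquiv S ℓ j i ↔ colEquiv S ℓ j' i := ⟨fun h' => h.symm'.trans' h', fun h' => h.trans' h'⟩

theorem colEquiv_succ (S : Fin k → J → I) (b : Fin k) (j j' : J) :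
    colEquiv S ((b : ℕ) + 1) j j' ↔ colEquiv S (b : ℕ) j j' ∧ S b j = S b j' := by
  constructor
  · intro h
    exact ⟨fun c hc => h c (by omega), h b (by omega)⟩
  · rintro ⟨h, h'⟩ c hc
    rcases Nat.lt_succ_iff_lt_or_eq.mp hc with h1 | h1
    · exact h c h1
    · have : c = b := Fin.ext h1
      subst this; exact h'

theorem stage_congr {S : Fin k → J → I} {b : Fin k} {j j' : J} (h : colEquiv S (b : ℕ) j j') :
    stage S b j = stage S b j' := by
  unfold stage
  congr 1
  ext i
  simp [colEquiv_congr h i]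

theorem mem_stage {S : Fin k → J → I} {b : Fin k} {j : J} {i : I} :
    i ∈ stage S b j ↔ ∃ j', colEquiv S (b : ℕ) j j' ∧ S b j' = i := by
  simp [stage]

theorem self_mem_stage (S : Fin k → J → I) (b : Fin k) (j : J) : S b j ∈ stage S b j :=
  mem_stage.2 ⟨j, colEquiv.refl' S _ j, rfl⟩

theorem floret_all {S : Fin k → J → I} (hs : Staged S) (b : Fin k) : FloretCondition S b := by
  rcases Nat.eq_zero_or_pos (b : ℕ) with h | h
  · intro j j'
    left
    exact stage_congr (fun c hc => by omega)
  · exact hs b h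

theorem mem_stage_iff {S : Fin k → J → I} (hs : Staged S) (b : Fin k) (j j' : J) :
    S b j' ∈ stage S b j ↔ stage S b j = stage S b j' := by
  constructor
  · intro h
    rcases floret_all hs b j j' with h1 | h1
    · exact h1
    · exact absurd (self_mem_stage S b j') (Finset.disjoint_left.1 h1 h)
  · intro h
    simpa only [h] using self_mem_stage S b j'

theorem colEquiv_zero (S : Fin k → J → I) (j i : J) : colEquiv S 0 j i :=
  fun _ hb => absurd hb (Nat.not_lt_zero _)

/-- The product of the values of the remaining edges of column `j`. -/
noncomputable def wt (S : Fin k → J → I) (x : Fin k × I → ℝ) (ℓ : ℕ) (j : J) : ℝ :=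
  ∏ b ∈ Finset.univ.filter (fun b : Fin k => ℓ ≤ (b : ℕ)), x (b, S b j)

/-- The value of the interpolating polynomial at `x`. -/
noncomputable def tv (S : Fin k → J → I) (x : Fin k × I → ℝ) (ℓ : ℕ) (j : J) : ℝ :=
  ∑ j' ∈ Finset.univ.filter (fun j' => colEquiv S ℓ j j'), wt S x ℓ j'

theorem eval_interp (S : Fin k → J → I) (x : Fin k × I → ℝ) (ℓ : ℕ) (j : J) :
    MvPolynomial.eval x (interp S ℓ j) = tv S x ℓ j := by
  simp [interp, tv, wt, map_sum, map_prod]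

theorem tv_congr {S : Fin k → J → I} {x : Fin k × I → ℝ} {ℓ : ℕ} {j j' : J}
    (h : colEquiv S ℓ j j') : tv S x ℓ j = tv S x ℓ j' := by
  unfold tv
  congr 1
  ext i
  simp [colEquiv_congr h i]

theorem wt_pos {S : Fin k → J → I} {x : Fin k × I → ℝ} (hx : ∀ e, 0 < x e) (ℓ : ℕ) (j : J) :
    0 < wt S x ℓ j := Finset.prod_pos fun _ _ => hx _

theorem tv_pos {S : Fin k → J → I} {x : Fin k × I → ℝ} (hx : ∀ e, 0 < x e) (ℓ : ℕ) (j : J) :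
    0 < tv S x ℓ j :=
  Finset.sum_pos (fun _ _ => wt_pos hx _ _) ⟨j, by simp [colEquiv.refl']⟩

theorem wt_succ (S : Fin k → J → I) (x : Fin k × I → ℝ) (b : Fin k) (j : J) :
    wt S x (b : ℕ) j = x (b, S b j) * wt S x ((b : ℕ) + 1) j := by
  unfold wt
  rw [← Finset.prod_insert (s := Finset.univ.filter (fun c : Fin k => (b : ℕ) + 1 ≤ (c : ℕ)))
    (a := b) (f := fun c => x (c, S c j)) (by simp)]
  congr 1
  ext c
  simp only [Finset.mem_filter, Finset.mem_univ, true_and, Finset.mem_insert, Fin.ext_iff]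
  omega

theorem fiber_eq {S : Fin k → J → I} {b : Fin k} {j j' : J} (h : colEquiv S (b : ℕ) j j') :
    (Finset.univ.filter (fun i => colEquiv S (b : ℕ) j i)).filter (fun i => S b i = S b j')
      = Finset.univ.filter (fun i => colEquiv S ((b : ℕ) + 1) j' i) := by
  ext i
  simp only [Finset.mem_filter, Finset.mem_univ, true_and, colEquiv_succ, colEquiv_congr h i,
    eq_comm]

/-- Sum over a class, grouped by the next edge. -/
theorem sum_class (S : Fin k → J → I) (b : Fin k) (j : J) (f : J → ℝ) :
    ∑ j' ∈ Finset.univ.filter (fun j' => colEquiv S (b : ℕ) j j'), f j' =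
    ∑ i ∈ stage S b j, ∑ j' ∈ (Finset.univ.filter
      (fun j' => colEquiv S (b : ℕ) j j')).filter (fun j' => S b j' = i), f j' := by
  rw [Finset.sum_fiberwise_of_maps_to]
  intro j' hj'
  exact Finset.mem_image_of_mem _ hj'

theorem tv_succ (S : Fin k → J → I) (x : Fin k × I → ℝ) (b : Fin k) (j : J) (g : I → J)
    (hg : ∀ i ∈ stage S b j, colEquiv S (b : ℕ) j (g i) ∧ S b (g i) = i) :
    tv S x (b : ℕ) j = ∑ i ∈ stage S b j, x (b, i) * tv S x ((b : ℕ) + 1) (g i) := by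
  unfold tv
  rw [sum_class]
  refine Finset.sum_congr rfl fun i hi => ?_
  obtain ⟨h1, h2⟩ := hg i hi
  rw [← fiber_eq h1, h2, Finset.mul_sum]
  refine Finset.sum_congr rfl fun j' hj' => ?_
  rw [wt_succ, (Finset.mem_filter.1 hj').2]

theorem tv_cross {S : Fin k → J → I} (hs : Staged S) (hb : Balanced S) (x : Fin k × I → ℝ)
    (b : Fin k) (j j' : J) (h : S b j = S b j') :
    tv S x ((b : ℕ) + 1) j * tv S x (b : ℕ) j' = tv S x ((b : ℕ) + 1) j' * tv S x (b : ℕ) j := by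
  rcases Nat.eq_zero_or_pos (b : ℕ) with h0 | h0
  · have e1 : colEquiv S (b : ℕ) j j' := fun c hc => by omega
    rw [tv_congr e1, tv_congr ((colEquiv_succ S b j j').2 ⟨e1, h⟩)]
  · have hst : stage S b j = stage S b j' :=
      (mem_stage_iff hs b j j').1 (h ▸ self_mem_stage S b j)
    have key : ∀ j : J, ∃ g : I → J,
        ∀ i ∈ stage S b j, colEquiv S (b : ℕ) j (g i) ∧ S b (g i) = i := by
      intro j
      have : ∀ i, ∃ j', i ∈ stage S b j → colEquiv S (b : ℕ) j j' ∧ S b j' = i := by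
        intro i
        by_cases hi : i ∈ stage S b j
        · obtain ⟨j', hj'⟩ := mem_stage.1 hi
          exact ⟨j', fun _ => hj'⟩
        · exact ⟨j, fun h => absurd h hi⟩
      choose g hg using this
      exact ⟨g, hg⟩
    obtain ⟨g, hg⟩ := key j
    obtain ⟨g', hg'⟩ := key j'
    rw [tv_succ S x b j g hg, tv_succ S x b j' g' hg', ← hst, Finset.mul_sum, Finset.mul_sum]
    refine Finset.sum_congr rfl fun i hi => ?_
    obtain ⟨a1, a2⟩ := hg i hi
    obtain ⟨a1', a2'⟩ := hg' i (hst ▸ hi)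
    have := congrArg (MvPolynomial.eval x) (hb b h0 j j' hst j (g i) j' (g' i)
      (colEquiv.refl' S _ j) a1 (colEquiv.refl' S _ j') a1' h (a2.trans a2'.symm))
    rw [map_mul, map_mul, eval_interp, eval_interp, eval_interp, eval_interp] at this
    linear_combination x (b, i) * this

theorem span_of_dep (S : Fin k → J → I) (ℓ : ℕ) (b : Fin k) (hb : (b : ℕ) < ℓ) (h : J → ℝ)
    (hh : ∀ j j', S b j = S b j' → h j = h j') :
    h ∈ Submodule.span ℝ (prefixRows S ℓ) := by
  have : ∃ g : I → ℝ, ∀ j, h j = g (S b j) := by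
    classical
    refine ⟨fun i => if hi : ∃ j, S b j = i then h hi.choose else 0, fun j => ?_⟩
    have hi : ∃ j', S b j' = S b j := ⟨j, rfl⟩
    simp only [hi, dif_pos]
    exact hh _ _ hi.choose_spec.symm
  obtain ⟨g, hg⟩ := this
  have e : h = ∑ i ∈ Finset.univ.image (S b), g i • rowVec S b i := by
    ext j
    simp only [Finset.sum_apply, Pi.smul_apply, rowVec, smul_eq_mul, mul_ite, mul_one, mul_zero]
    rw [Finset.sum_ite_eq]
    simp [hg]
  rw [e]
  refine Submodule.sum_mem _ fun i _ => Submodule.smul_mem _ _ (Submodule.subset_span ?_)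
  exact ⟨b, i, hb, rfl⟩

theorem const_span (S : Fin k → J → I) (ℓ : ℕ) (b : Fin k) (hb : (b : ℕ) < ℓ) (c : ℝ) :
    (fun _ : J => c) ∈ Submodule.span ℝ (prefixRows S ℓ) :=
  span_of_dep S ℓ b hb _ fun _ _ _ => rfl

theorem span_mono (S : Fin k → J → I) {ℓ ℓ' : ℕ} (h : ℓ ≤ ℓ') :
    Submodule.span ℝ (prefixRows S ℓ) ≤ Submodule.span ℝ (prefixRows S ℓ') := by
  refine Submodule.span_mono ?_
  rintro v ⟨b, i, hb, rfl⟩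
  exact ⟨b, i, by omega, rfl⟩

theorem log_tv_span {S : Fin k → J → I} (hs : Staged S) (hb : Balanced S) (x : Fin k × I → ℝ)
    (hx : ∀ e, 0 < x e) (ℓ : ℕ) (h0 : 0 < ℓ) (hk : ℓ ≤ k) :
    (fun j => Real.log (tv S x ℓ j)) ∈ Submodule.span ℝ (prefixRows S ℓ) := by
  induction ℓ with
  | zero => omega
  | succ n ih =>
    let b : Fin k := ⟨n, by omega⟩
    have e : (fun j => Real.log (tv S x (n + 1) j)) =
        (fun j => Real.log (tv S x (n + 1) j) - Real.log (tv S x n j)) +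
          fun j => Real.log (tv S x n j) := by
      ext j; simp
    rw [e]
    refine Submodule.add_mem _ (span_of_dep S _ b (by simp [b]) _ ?_) ?_
    · intro j j' h
      have := tv_cross hs hb x b j j' h
      have p1 := tv_pos (S := S) hx (n + 1) j
      have p2 := tv_pos (S := S) hx (n + 1) j'
      have p3 := tv_pos (S := S) hx n j
      have p4 := tv_pos (S := S) hx n j'
      have := congrArg Real.log this
      change Real.log (tv S x (n + 1) j * tv S x n j') =
        Real.log (tv S x (n + 1) j' * tv S x n j) at this
      rw [Real.log_mul p1.ne' p4.ne', Real.log_mul p2.ne' p3.ne'] at this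
      linarith
    · rcases Nat.eq_zero_or_pos n with hn | hn
      · refine span_of_dep S _ b (by simp [b]) _ ?_
        intro j j' _
        rw [tv_congr (j := j) (j' := j') (fun c hc => by omega)]
      · exact span_mono S (Nat.le_succ n) (ih hn (by omega))

theorem dRow_span {S : Fin k → J → I} (hs : Staged S) (hb : Balanced S) (b : Fin k)
    (h0 : 0 < (b : ℕ)) (j0 : J) :
    dRow S b j0 ∈ Submodule.span ℝ (prefixRows S (b : ℕ)) := by
  classical
  let x : Fin k × I → ℝ := fun e => if e.1 = b ∧ e.2 ∈ stage S b j0 then 2 else 1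
  have hx : ∀ e, 0 < x e := by
    intro e; simp only [x]; split_ifs <;> norm_num
  have hw1 : ∀ ℓ j, wt S (fun _ => 1) ℓ j = 1 := by
    intro ℓ j; simp [wt]
  have hw : ∀ j, wt S x (b : ℕ) j = if stage S b j = stage S b j0 then 2 else 1 := by
    intro j
    rw [wt_succ]
    have : wt S x ((b : ℕ) + 1) j = 1 := by
      refine Finset.prod_eq_one fun c hc => ?_
      have : c ≠ b := by
        rintro rfl
        simp at hc
      simp [x, this]
    rw [this, mul_one]
    simp only [x, true_and, mem_stage_iff hs, eq_comm]
  have ht : ∀ j, tv S x (b : ℕ) j =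
      (if stage S b j = stage S b j0 then 2 else 1) * tv S (fun _ => 1) (b : ℕ) j := by
    intro j
    unfold tv
    rw [Finset.mul_sum]
    refine Finset.sum_congr rfl fun j' hj' => ?_
    rw [hw, hw1, stage_congr (Finset.mem_filter.1 hj').2, mul_one]
  have e : dRow S b j0 = (Real.log 2)⁻¹ • ((fun j => Real.log (tv S x (b : ℕ) j)) -
      fun j => Real.log (tv S (fun _ => 1) (b : ℕ) j)) := by
    have hl : Real.log 2 ≠ 0 := (Real.log_pos (by norm_num)).ne'
    ext j
    have p := tv_pos (S := S) (x := fun _ => 1) (fun _ => one_pos) (b : ℕ) j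
    simp only [Pi.smul_apply, Pi.sub_apply, smul_eq_mul, dRow, ht]
    split_ifs
    · rw [Real.log_mul (by norm_num) p.ne']
      field_simp
      ring
    · simp
  rw [e]
  exact Submodule.smul_mem _ _ (Submodule.sub_mem _
    (log_tv_span hs hb x hx _ h0 b.2.le) (log_tv_span hs hb _ (fun _ => one_pos) _ h0 b.2.le))

/-- Number of columns in a class, as a real. -/
noncomputable def cw (S : Fin k → J → I) (ℓ : ℕ) (j : J) : ℝ := tv S (fun _ => 1) ℓ j

theorem cw_eq (S : Fin k → J → I) (ℓ : ℕ) (j : J) : cw S ℓ j =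
    ∑ j' ∈ Finset.univ.filter (fun j' => colEquiv S ℓ j j'), (1 : ℝ) := by
  simp [cw, tv, wt]

theorem cw_pos (S : Fin k → J → I) (ℓ : ℕ) (j : J) : 0 < cw S ℓ j :=
  tv_pos (fun _ => one_pos) ℓ j

theorem averaging (S : Fin k → J → I) (ℓ : ℕ) (g φ : J → ℝ)
    (hg : ∀ j j', colEquiv S ℓ j j' → g j = g j') :
    ∑ j, g j * φ j =
      ∑ j, g j * ((∑ j' ∈ Finset.univ.filter (fun j' => colEquiv S ℓ j j'), φ j') / cw S ℓ j) := by
  have h1 : ∀ j, g j * ((∑ j' ∈ Finset.univ.filter (fun j' => colEquiv S ℓ j j'), φ j')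
      / cw S ℓ j) = ∑ j', if colEquiv S ℓ j j' then g j' * φ j' / cw S ℓ j' else 0 := by
    intro j
    rw [← Finset.sum_filter, Finset.sum_div, Finset.mul_sum]
    refine Finset.sum_congr rfl fun j' hj' => ?_
    have h := (Finset.mem_filter.1 hj').2
    rw [hg j j' h, show cw S ℓ j = cw S ℓ j' from tv_congr h]
    ring
  simp_rw [h1]
  rw [Finset.sum_comm]
  refine Finset.sum_congr rfl fun j' _ => ?_
  simp_rw [colEquiv_comm S ℓ _ j']
  rw [← Finset.sum_filter]
  have : ∑ a ∈ Finset.univ.filter (fun a => colEquiv S ℓ j' a), g j' * φ j' / cw S ℓ j' =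
      g j' * φ j' / cw S ℓ j' * cw S ℓ j' := by
    rw [cw_eq S ℓ j', Finset.mul_sum]; simp
  rw [this]
  field_simp [(cw_pos S ℓ j').ne']

theorem span_dot (S : Fin k → J → I) (ℓ : ℕ) (q d : J → ℝ)
    (hm : ∀ b : Fin k, (b : ℕ) < ℓ → ∀ i, rowDot S b i q = rowDot S b i d)
    (v : J → ℝ) (hv : v ∈ Submodule.span ℝ (prefixRows S ℓ)) :
    ∑ j, q j * v j = ∑ j, d j * v j := by
  induction hv using Submodule.span_induction with
  | mem v hv =>
    obtain ⟨b, i, hb, rfl⟩ := hv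
    have := hm b hb i
    simpa [rowDot, rowVec] using this
  | zero => simp
  | add v w _ _ h1 h2 => simp [mul_add, Finset.sum_add_distrib, h1, h2]
  | smul a v _ h =>
    have : ∀ q : J → ℝ, ∑ j, q j * (a • v) j = a * ∑ j, q j * v j := by
      intro q
      rw [Finset.mul_sum]
      refine Finset.sum_congr rfl fun j _ => ?_
      simp; ring
    rw [this, this, h]

/-- The invariant of the scaling iteration. -/
structure Inv (S : Fin k → J → I) (d : J → ℝ) (ℓ : ℕ) (q : J → ℝ) : Prop where
  pos : ∀ j, 0 < q j
  inv : ∀ j j', colEquiv S ℓ j j' → q j = q j'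
  sum : ∑ j, q j = ∑ j, d j
  marg : ∀ b : Fin k, (b : ℕ) < ℓ → ∀ i, rowDot S b i q = rowDot S b i d

theorem dRow_dot {S : Fin k → J → I} (hs : Staged S) (hb : Balanced S) {d q : J → ℝ} (b : Fin k)
    (hq : Inv S d (b : ℕ) q) (j0 : J) :
    ∑ j, q j * dRow S b j0 j = ∑ j, d j * dRow S b j0 j := by
  rcases Nat.eq_zero_or_pos (b : ℕ) with h0 | h0
  · have : ∀ j, dRow S b j0 j = 1 := by
      intro j
      unfold dRow
      rw [if_pos (stage_congr (fun c hc => by omega))]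
    simp [this, hq.sum]
  · exact span_dot S _ q d hq.marg _ (dRow_span hs hb b h0 j0)

theorem rowDot_pos {S : Fin k → J → I} (b : Fin k) (j : J) {q : J → ℝ} (hq : ∀ j, 0 < q j) :
    0 < rowDot S b (S b j) q := by
  unfold rowDot
  rw [← Finset.sum_filter]
  exact Finset.sum_pos (fun i _ => hq i) ⟨j, by simp⟩

theorem rowDot_q {S : Fin k → J → I} (hs : Staged S) (hb : Balanced S) {d q : J → ℝ} (b : Fin k)
    (hq : Inv S d (b : ℕ) q) (j0 : J) :
    rowDot S b (S b j0) q =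
      cw S ((b : ℕ) + 1) j0 / cw S (b : ℕ) j0 * ∑ j, d j * dRow S b j0 j := by
  rw [← dRow_dot hs hb b hq j0]
  have e : rowDot S b (S b j0) q = ∑ j, q j * (if S b j = S b j0 then 1 else 0) := by
    simp [rowDot]
  rw [e, averaging S (b : ℕ) q _ hq.inv, Finset.mul_sum]
  refine Finset.sum_congr rfl fun j _ => ?_
  rw [← Finset.sum_filter]
  unfold dRow
  split_ifs with h
  · obtain ⟨j', h1, h2⟩ := mem_stage.1 ((mem_stage_iff hs b j j0).2 h)
    rw [← h2, fiber_eq h1, ← cw_eq]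
    have hc := tv_cross hs hb (fun _ => 1) b j' j0 h2
    change cw S ((b : ℕ) + 1) j' * cw S (b : ℕ) j0 = cw S ((b : ℕ) + 1) j0 * cw S (b : ℕ) j' at hc
    rw [show cw S (b : ℕ) j = cw S (b : ℕ) j' from tv_congr h1]
    have p1 := (cw_pos S (b : ℕ) j').ne'
    have p2 := (cw_pos S (b : ℕ) j0).ne'
    field_simp
    linear_combination q j * hc
  · rw [Finset.sum_eq_zero]
    · simp
    · intro j' hj'
      simp only [Finset.mem_filter, Finset.mem_univ, true_and] at hj'
      exact absurd ((mem_stage_iff hs b j j0).1 (mem_stage.2 ⟨j', hj'⟩)) h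

theorem class_avg {S : Fin k → J → I} (hs : Staged S) (d : J → ℝ) (b : Fin k) (j : J) :
    ∑ j' ∈ Finset.univ.filter (fun j' => colEquiv S (b : ℕ) j j'),
      rowDot S b (S b j') d / cw S ((b : ℕ) + 1) j' = ∑ j', d j' * dRow S b j j' := by
  rw [sum_class]
  have h1 : ∀ i ∈ stage S b j, ∑ j' ∈ (Finset.univ.filter
      (fun j' => colEquiv S (b : ℕ) j j')).filter (fun j' => S b j' = i),
      rowDot S b (S b j') d / cw S ((b : ℕ) + 1) j' = rowDot S b i d := by
    intro i hi
    obtain ⟨j', a1, rfl⟩ := mem_stage.1 hi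
    rw [fiber_eq a1]
    have : ∀ i ∈ Finset.univ.filter (fun i => colEquiv S ((b : ℕ) + 1) j' i),
        rowDot S b (S b i) d / cw S ((b : ℕ) + 1) i =
          rowDot S b (S b j') d / cw S ((b : ℕ) + 1) j' * 1 := by
      intro i hi
      have h := (Finset.mem_filter.1 hi).2
      rw [show cw S ((b : ℕ) + 1) j' = cw S ((b : ℕ) + 1) i from tv_congr h,
        ((colEquiv_succ S b _ _).1 h).2, mul_one]
    rw [Finset.sum_congr rfl this, ← Finset.mul_sum, ← cw_eq]
    field_simp [(cw_pos S ((b : ℕ) + 1) j').ne']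
  rw [Finset.sum_congr rfl h1]
  unfold rowDot
  rw [Finset.sum_comm]
  refine Finset.sum_congr rfl fun j' _ => ?_
  rw [Finset.sum_ite_eq]
  unfold dRow
  simp only [mem_stage_iff hs, mul_ite, mul_one, mul_zero, eq_comm]

theorem ips_succ (S : Fin k → J → I) (d : J → ℝ) (b : Fin k) (j : J) :
    ips S d ((b : ℕ) + 1) j = ips S d (b : ℕ) j * rowDot S b (S b j) d /
      rowDot S b (S b j) (ips S d (b : ℕ)) := by
  simp [ips]

theorem inv_step {S : Fin k → J → I} (hs : Staged S) (hb : Balanced S) {d : J → ℝ}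
    (hd : ∀ j, 0 < d j) (b : Fin k) (hq : Inv S d (b : ℕ) (ips S d (b : ℕ))) :
    Inv S d ((b : ℕ) + 1) (ips S d ((b : ℕ) + 1)) := by
  set q := ips S d (b : ℕ) with hqdef
  have hF : ∀ j0, 0 < ∑ j, d j * dRow S b j0 j := by
    intro j0
    refine Finset.sum_pos' (fun j _ => ?_) ⟨j0, Finset.mem_univ _, ?_⟩
    · unfold dRow
      have := hd j
      split_ifs <;> simp [this.le]
    · simp [dRow, hd j0]
  have pres : ∀ h : J → ℝ, (∀ j j', colEquiv S (b : ℕ) j j' → h j = h j') →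
      ∑ j, ips S d ((b : ℕ) + 1) j * h j = ∑ j, q j * h j := by
    intro h hh
    have e : ∀ j, ips S d ((b : ℕ) + 1) j * h j =
        (q j * h j * cw S (b : ℕ) j / ∑ j', d j' * dRow S b j j') *
          (rowDot S b (S b j) d / cw S ((b : ℕ) + 1) j) := by
      intro j
      rw [ips_succ, ← hqdef, rowDot_q hs hb b hq j]
      have p1 := (cw_pos S (b : ℕ) j).ne'
      have p2 := (cw_pos S ((b : ℕ) + 1) j).ne'
      have p3 := (hF j).ne'
      field_simp
    rw [Finset.sum_congr rfl fun j _ => e j, averaging S (b : ℕ)]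
    · refine Finset.sum_congr rfl fun j _ => ?_
      rw [class_avg hs]
      have p1 := (cw_pos S (b : ℕ) j).ne'
      have p3 := (hF j).ne'
      field_simp
    · intro j j' hj
      rw [hq.inv j j' hj, hh j j' hj, show cw S (b : ℕ) j = cw S (b : ℕ) j' from tv_congr hj]
      simp only [dRow, stage_congr hj]
  refine ⟨fun j => ?_, fun j j' h => ?_, ?_, fun c hc i => ?_⟩
  · rw [ips_succ]
    exact div_pos (mul_pos (hq.pos j) (rowDot_pos b j hd)) (rowDot_pos b j hq.pos)
  · obtain ⟨h1, h2⟩ := (colEquiv_succ S b j j').1 h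
    rw [ips_succ, ips_succ, ← hqdef, hq.inv j j' h1, h2]
  · have := pres (fun _ => 1) (fun _ _ _ => rfl)
    simp only [mul_one] at this
    rw [this, hq.sum]
  · rcases Nat.lt_succ_iff_lt_or_eq.mp hc with h1 | h1
    · rw [← hq.marg c h1 i]
      have := pres (rowVec S c i) (fun j j' h => by simp [rowVec, h c h1])
      simpa [rowVec, rowDot] using this
    · have : c = b := Fin.ext h1
      subst this
      have e : ∀ j, (if S c j = i then ips S d ((c : ℕ) + 1) j else 0) =
          (if S c j = i then q j else 0) * (rowDot S c i d / rowDot S c i q) := by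
        intro j
        split_ifs with h
        · rw [ips_succ, h, ← hqdef]; ring
        · simp
      have e2 : rowDot S c i (ips S d ((c : ℕ) + 1)) =
          rowDot S c i q * (rowDot S c i d / rowDot S c i q) := by
        conv_lhs => unfold rowDot
        rw [Finset.sum_congr rfl fun j _ => e j, ← Finset.sum_mul]
        rfl
      rw [e2]
      by_cases hi : ∃ j, S c j = i
      · obtain ⟨j, rfl⟩ := hi
        have := (rowDot_pos (S := S) c j hq.pos).ne'
        field_simp
      · push Not at hi
        have z : ∀ q : J → ℝ, rowDot S c i q = 0 := by
          intro q; simp [rowDot, hi]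
        simp [z]

theorem inv_all {S : Fin k → J → I} (hs : Staged S) (hb : Balanced S) {d : J → ℝ}
    (hd : ∀ j, 0 < d j) (hd1 : ∑ j, d j = 1) (ℓ : ℕ) (hℓ : ℓ ≤ k) :
    Inv S d ℓ (ips S d ℓ) := by
  induction ℓ with
  | zero =>
    have hne : Nonempty J := by
      by_contra h
      rw [not_nonempty_iff] at h
      simp at hd1
    have hc : (0 : ℝ) < Fintype.card J := by exact_mod_cast Fintype.card_pos
    refine ⟨fun j => ?_, fun j j' h => rfl, ?_, fun c hc => by omega⟩
    · simp only [ips]; positivity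
    · rw [hd1]; simp [ips, hc.ne']
  | succ n ih => exact inv_step hs hb hd ⟨n, by omega⟩ (ih (by omega))

theorem log_ips_span {S : Fin k → J → I} (hs : Staged S) (hb : Balanced S) {d : J → ℝ}
    (hd : ∀ j, 0 < d j) (hd1 : ∑ j, d j = 1) (ℓ : ℕ) (hℓ : ℓ ≤ k) (h0 : 0 < k) :
    (fun j => Real.log (ips S d ℓ j)) ∈ Submodule.span ℝ (prefixRows S k) := by
  induction ℓ with
  | zero => exact span_of_dep S k ⟨0, h0⟩ h0 _ fun _ _ _ => rfl
  | succ n ih =>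
    let b : Fin k := ⟨n, by omega⟩
    have hq := inv_all hs hb hd hd1 n (by omega)
    have e : (fun j => Real.log (ips S d (n + 1) j)) = (fun j => Real.log (ips S d n j)) +
        fun j => Real.log (rowDot S b (S b j) d / rowDot S b (S b j) (ips S d n)) := by
      ext j
      have := ips_succ S d b j
      change ips S d (n + 1) j = ips S d n j * rowDot S b (S b j) d /
        rowDot S b (S b j) (ips S d n) at this
      rw [this, mul_div_assoc, Real.log_mul (hq.pos j).ne'
        (div_pos (rowDot_pos b j hd) (rowDot_pos b j hq.pos)).ne']
      rfl
    rw [e]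
    refine Submodule.add_mem _ (ih (by omega)) (span_of_dep S k b b.2 _ ?_)
    intro j j' h
    simp only [h]

theorem log_likelihood {d p : J → ℝ} (hp : ∀ j, 0 < p j) :
    likelihood d p = Real.exp (∑ j, d j * Real.log (p j)) := by
  rw [likelihood, Real.exp_sum]
  refine Finset.prod_congr rfl fun j _ => ?_
  rw [Real.rpow_def_of_pos (hp j), mul_comm]

theorem gibbs {p q : J → ℝ} (hp : ∀ j, 0 < p j) (hq : ∀ j, 0 < q j)
    (h : ∑ j, q j = ∑ j, p j) :
    ∑ j, p j * Real.log (q j) ≤ ∑ j, p j * Real.log (p j) := by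
  have : ∀ j, p j * Real.log (q j) ≤ p j * Real.log (p j) + (q j - p j) := by
    intro j
    have h1 := Real.log_le_sub_one_of_pos (div_pos (hq j) (hp j))
    rw [Real.log_div (hq j).ne' (hp j).ne'] at h1
    have h2 := mul_le_mul_of_nonneg_left h1 (hp j).le
    have h3 : p j * (q j / p j - 1) = q j - p j := by
      have := (hp j).ne'
      field_simp
    linarith
  have h2 := Finset.sum_le_sum fun j (_ : j ∈ Finset.univ) => this j
  rw [Finset.sum_add_distrib, Finset.sum_sub_distrib, h] at h2
  linarith

theorem isMLE_of_marg {S : Fin k → J → I} {d p : J → ℝ} (hd : ∀ j, 0 < d j)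
    (hp : inModel (prefixRows S k) p)
    (hm : ∀ b : Fin k, (b : ℕ) < k → ∀ i, rowDot S b i p = rowDot S b i d) :
    IsMLE (prefixRows S k) d p := by
  refine ⟨subset_closure hp, fun q hq => ?_⟩
  have hcont : Continuous (likelihood d) := by
    unfold likelihood
    refine continuous_finsetProd _ fun j _ => ?_
    exact (continuous_apply j).rpow_const fun _ => Or.inr (hd j).le
  have hcl : IsClosed {q | likelihood d q ≤ likelihood d p} :=
    isClosed_le hcont continuous_const
  refine closure_minimal ?_ hcl hq
  rintro r ⟨r1, r2, r3⟩
  obtain ⟨p1, p2, p3⟩ := hp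
  change likelihood d r ≤ likelihood d p
  rw [log_likelihood r1, log_likelihood p1, Real.exp_le_exp,
    ← span_dot S k p d hm _ r3, ← span_dot S k p d hm _ p3]
  exact gibbs p1 r1 (r2.trans p2.symm)

end Aux

end PM

open Finset PM in
/-- Corollary 4.6.  Let `A` (encoded by `S`) be a multipartition
matrix with `k` blocks and `m` pairwise distinct columns which is staged and balanced
(equivalently, the matrix of a stratified, balanced staged tree), and let `d` be a
normalized data vector with positive entries.  Then the iterative proportional scaling
algorithm, started from the uniform distribution, produces the maximum likelihood
estimate of `d` in the partition model `M_A` after one cycle (after `k` steps). -/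
theorem balanced_one_cycle {k m : ℕ} (S : Fin k → Fin m → ℕ)
    (hdist : ∀ j j' : Fin m, (∀ b : Fin k, S b j = S b j') → j = j')
    (hstaged : Staged S) (hbal : Balanced S)
    (d : Fin m → ℝ) (hd : ∀ j, 0 < d j) (hd1 : (∑ j, d j) = 1) :
    IsMLE (prefixRows S k) d (ips S d k) := by
  have hI := inv_all hstaged hbal hd hd1 k le_rfl
  refine isMLE_of_marg hd ⟨hI.pos, hI.sum.trans hd1, ?_⟩ hI.marg
  rcases Nat.eq_zero_or_pos k with h0 | h0
  · subst h0
    have : (fun j => Real.log (ips S d 0 j)) = 0 := by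
      ext j
      have hsub : ∀ j' : Fin m, j' = j := fun j' => hdist j' j fun b => b.elim0
      have hs : ∑ j', ips S d 0 j' = ips S d 0 j := by
        rw [Finset.sum_eq_single j (fun j' _ h => absurd (hsub j') h) (by simp)]
      have h1 := hI.sum.trans hd1
      rw [hs] at h1
      simp only [h1, Real.log_one, Pi.zero_apply]
    rw [this]
    exact Submodule.zero_mem _
  · exact log_ips_span hstaged hbal hd hd1 k le_rfl h0
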